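/- Let X be a metric space with Borel σ-algebra Σ, let (a_k)_{k=1}^∞ ⊆ [0,1] with Σ_{k=1}^∞ a_k = 1, and let (μ_k)_{k=1}^∞ be Borel probability measures on X. Then ldim_E(Σ_{k=1}^∞ a_k μ_k) ≥ Σ_{k=1}^∞ a_k ldim_E(μ_k). -/

import Mathlib

open MeasureTheory ENNReal

/-- The Shannon function `sh(x) = -x·log₂ x` (with `sh 0 = 0`). -/
noncomputable def sh (x : ℝ) : ℝ := -(x * Real.logb 2 x)

/-- `P` is a `μ`-partition of `X`: a countable family of pairwise disjoint
measurable sets covering `X` up to a `μ`-null set. -/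
def IsMuPartition {X : Type*} [MeasurableSpace X] (μ : Measure X) (P : Set (Set X)) : Prop :=
  P.Countable ∧ (∀ s ∈ P, MeasurableSet s) ∧ P.Pairwise Disjoint ∧ μ (⋃₀ P)ᶜ = 0

/-- The `μ`-entropy `h(μ;P) = Σ_{P∈P} sh(μ(P))` of a family of sets. -/
noncomputable def partEntropy {X : Type*} [MeasurableSpace X] (μ : Measure X)
    (P : Set (Set X)) : ℝ≥0∞ :=
  ∑' s : P, ENNReal.ofReal (sh (μ s).toReal)

/-- `P ≺ Q` : every element of `P` is contained in some element of `Q`. -/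
def Finer {X : Type*} (P Q : Set (Set X)) : Prop := ∀ p ∈ P, ∃ q ∈ Q, p ⊆ q

/-- The (classical) `μ`-entropy of a family `Q`:
`H(μ;Q) = inf { h(μ;P) : P a μ-partition, P ≺ Q }`, with `inf ∅ = ∞`. -/
noncomputable def entropyH {X : Type*} [MeasurableSpace X] (μ : Measure X)
    (Q : Set (Set X)) : ℝ≥0∞ :=
  ⨅ (P : Set (Set X)) (_ : IsMuPartition μ P) (_ : Finer P Q), partEntropy μ P

/-- `m ∈ V(μ;Q)` : a weighting of `Q`, i.e. `m : Q → Measure X` with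
`m_Q(X \ Q) = 0` for all `Q ∈ Q` and `Σ_{Q∈Q} m_Q = μ`. -/
def IsWeighting {X : Type*} [MeasurableSpace X] (μ : Measure X) (Q : Set (Set X))
    (m : Q → Measure X) : Prop :=
  (∀ q : Q, m q ((q : Set X))ᶜ = 0) ∧ Measure.sum m = μ

/-- The weighted `μ`-entropy of `m ∈ V(μ;Q)` : `hv(μ;m) = Σ_{Q∈Q} sh(m_Q(X))`. -/
noncomputable def wEntropy {X : Type*} [MeasurableSpace X] (Q : Set (Set X))
    (m : Q → Measure X) : ℝ≥0∞ :=
  ∑' q : Q, ENNReal.ofReal (sh ((m q) Set.univ).toReal)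

/-- The weighted `μ`-entropy of `Q` : `Hv(μ;Q) = inf { hv(μ;m) : m ∈ V(μ;Q) }`,
with `inf ∅ = ∞`. -/
noncomputable def entropyHv {X : Type*} [MeasurableSpace X] (μ : Measure X)
    (Q : Set (Set X)) : ℝ≥0∞ :=
  ⨅ (m : Q → Measure X) (_ : IsWeighting μ Q m), wEntropy Q m

/-- The family of all closed balls of radius `δ`. -/
def ballFam (X : Type*) [PseudoMetricSpace X] (δ : ℝ) : Set (Set X) :=
  Set.range (fun x : X => Metric.closedBall x δ)

/-- The lower entropy dimension `liminf_{δ→0⁺} H(μ;B_δ)/(-log₂ δ)`. -/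
noncomputable def ldimE {X : Type*} [PseudoMetricSpace X] [MeasurableSpace X]
    (μ : Measure X) : ℝ≥0∞ :=
  Filter.liminf (fun δ : ℝ => entropyH μ (ballFam X δ) / ENNReal.ofReal (-Real.logb 2 δ))
    (nhdsWithin 0 (Set.Ioi 0))

/-- The upper entropy dimension `limsup_{δ→0⁺} H(μ;B_δ)/(-log₂ δ)`. -/
noncomputable def udimE {X : Type*} [PseudoMetricSpace X] [MeasurableSpace X]
    (μ : Measure X) : ℝ≥0∞ :=
  Filter.limsup (fun δ : ℝ => entropyH μ (ballFam X δ) / ENNReal.ofReal (-Real.logb 2 δ))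
    (nhdsWithin 0 (Set.Ioi 0))

/-- `N_δ(S)` : the smallest number of closed balls of radius `δ` needed to cover `S`. -/
noncomputable def coverNum {X : Type*} [PseudoMetricSpace X] (S : Set X) (δ : ℝ) : ℝ≥0∞ :=
  ⨅ (t : Finset X) (_ : S ⊆ ⋃ x ∈ t, Metric.closedBall x δ), (t.card : ℝ≥0∞)

/-- The natural logarithm on `ℝ≥0∞` (with `log ∞ = ∞`), truncated to `ℝ≥0∞`. -/
noncomputable def logENN (x : ℝ≥0∞) : ℝ≥0∞ :=
  if x = ⊤ then ⊤ else ENNReal.ofReal (Real.log x.toReal)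

/-- The upper box dimension `limsup_{δ→0⁺} log N_δ(S)/(-log δ)`. -/
noncomputable def ubdimB {X : Type*} [PseudoMetricSpace X] (S : Set X) : ℝ≥0∞ :=
  Filter.limsup (fun δ : ℝ => logENN (coverNum S δ) / ENNReal.ofReal (-Real.log δ))
    (nhdsWithin 0 (Set.Ioi 0))

/-- The upper local dimension `D̄_μ(x) = limsup_{δ→0⁺} log μ(B(x,δ))/log δ`
(interpreted as `∞` when `μ(B(x,δ)) = 0`). -/
noncomputable def upLocalDim {X : Type*} [PseudoMetricSpace X] [MeasurableSpace X]
    (μ : Measure X) (x : X) : ℝ≥0∞ :=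
  Filter.limsup
    (fun δ : ℝ => if μ (Metric.closedBall x δ) = 0 then ⊤ else
      ENNReal.ofReal (Real.log (μ (Metric.closedBall x δ)).toReal / Real.log δ))
    (nhdsWithin 0 (Set.Ioi 0))

lemma sh_eq_negMulLog_div (x : ℝ) : sh x = Real.negMulLog x / Real.log 2 := by
  simp only [sh, Real.negMulLog, Real.logb]
  ring

lemma sh_nonneg {x : ℝ} (h0 : 0 ≤ x) (h1 : x ≤ 1) : 0 ≤ sh x := by
  rw [sh_eq_negMulLog_div]
  exact div_nonneg (Real.negMulLog_nonneg h0 h1) (Real.log_nonneg one_le_two)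

/-- The graph of the Shannon function lies below its tangent at `y`. -/
lemma sh_le_tangent {x y : ℝ} (hx : 0 ≤ x) (hy : 0 < y) :
    sh x ≤ (y - x - x * Real.log y) / Real.log 2 := by
  rw [sh_eq_negMulLog_div]
  refine div_le_div_of_nonneg_right ?_ (Real.log_nonneg one_le_two)
  rcases hx.eq_or_lt with rfl | hx
  · simpa using hy.le
  · have h := mul_le_mul_of_nonneg_left (Real.log_le_sub_one_of_pos (div_pos hy hx)) hx.le
    rw [Real.log_div hy.ne' hx.ne', mul_sub, mul_sub, mul_div_cancel₀ y hx.ne'] at h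
    rw [Real.negMulLog]
    linarith

/-- Jensen's inequality for the Shannon function and countable convex combinations. -/
lemma tsum_ofReal_mul_sh_le {a x : ℕ → ℝ} (ha : ∀ k, 0 ≤ a k) (hsum : HasSum a 1)
    (hx : ∀ k, x k ∈ Set.Icc (0 : ℝ) 1) {y : ℝ} (hy : HasSum (fun k => a k * x k) y) :
    ∑' k, ENNReal.ofReal (a k) * ENNReal.ofReal (sh (x k)) ≤ ENNReal.ofReal (sh y) := by
  simp_rw [← ENNReal.ofReal_mul (ha _)]
  have hax : ∀ k, 0 ≤ a k * x k := fun k => mul_nonneg (ha k) (hx k).1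
  rcases (hy.nonneg hax).eq_or_lt with rfl | hypos
  · have hzero := (hasSum_zero_iff_of_nonneg hax).1 hy
    have hterm : ∀ k, a k * sh (x k) = 0 := fun k => by
      have hk : a k * x k = 0 := congrFun hzero k
      rw [sh]
      linear_combination -(Real.logb 2 (x k)) * hk
    simp [hterm]
  · have hle : ∀ k, a k * sh (x k) ≤ a k * ((y - x k - x k * Real.log y) / Real.log 2) :=
      fun k => mul_le_mul_of_nonneg_left (sh_le_tangent (hx k).1 hypos) (ha k)
    have hnonneg : ∀ k, 0 ≤ a k * ((y - x k - x k * Real.log y) / Real.log 2) :=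
      fun k => (mul_nonneg (ha k) (sh_nonneg (hx k).1 (hx k).2)).trans (hle k)
    have htangent :
        HasSum (fun k => a k * ((y - x k - x k * Real.log y) / Real.log 2)) (sh y) := by
      convert! (((hsum.mul_right y).sub hy).sub (hy.mul_right (Real.log y))).div_const
        (Real.log 2) using 1
      · funext k
        ring
      · rw [sh_eq_negMulLog_div, Real.negMulLog]
        ring
    calc ∑' k, ENNReal.ofReal (a k * sh (x k))
        ≤ ∑' k, ENNReal.ofReal (a k * ((y - x k - x k * Real.log y) / Real.log 2)) :=
          ENNReal.tsum_le_tsum fun k => ENNReal.ofReal_le_ofReal (hle k)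
      _ = ENNReal.ofReal (sh y) := by
          rw [← ENNReal.ofReal_tsum_of_nonneg hnonneg htangent.summable, htangent.tsum_eq]

lemma hasSum_mul_toReal_measure {X : Type*} [MeasurableSpace X] {a : ℕ → ℝ}
    (ha : ∀ k, 0 ≤ a k) (hsum : Summable a) (μ : ℕ → Measure X)
    [∀ k, IsProbabilityMeasure (μ k)] {s : Set X} (hs : MeasurableSet s) :
    HasSum (fun k => a k * (μ k s).toReal)
      (Measure.sum (fun k => ENNReal.ofReal (a k) • μ k) s).toReal := by
  have hterm : ∀ k, (ENNReal.ofReal (a k) * μ k s).toReal = a k * (μ k s).toReal := fun k => by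
    rw [ENNReal.toReal_mul, ENNReal.toReal_ofReal (ha k)]
  have hfin : ∑' k, ENNReal.ofReal (a k) * μ k s ≠ ⊤ := by
    refine ne_top_of_le_ne_top (ENNReal.ofReal_ne_top (r := ∑' k, a k)) ?_
    rw [ENNReal.ofReal_tsum_of_nonneg ha hsum]
    exact ENNReal.tsum_le_tsum fun k => mul_le_of_le_one_right' prob_le_one
  simp only [Measure.sum_apply _ hs, Measure.smul_apply, smul_eq_mul, ← hterm]
  rw [ENNReal.tsum_toReal_eq (ENNReal.ne_top_of_tsum_ne_top hfin)]
  exact ENNReal.hasSum_toReal hfin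

/-- Entropy at a fixed scale is concave under countable mixtures. -/
lemma tsum_mul_entropyH_le {X : Type*} [MeasurableSpace X] {a : ℕ → ℝ}
    (ha : ∀ k, 0 ≤ a k) (hsum : HasSum a 1) (μ : ℕ → Measure X)
    [∀ k, IsProbabilityMeasure (μ k)] (Q : Set (Set X)) :
    ∑' k, ENNReal.ofReal (a k) * entropyH (μ k) Q ≤
      entropyH (Measure.sum (fun k => ENNReal.ofReal (a k) • μ k)) Q := by
  refine le_iInf fun P => le_iInf fun hP => le_iInf fun hPQ => ?_
  obtain ⟨hcount, hmeas, hdisj, hnull⟩ := hP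
  have hk : ∀ k, ENNReal.ofReal (a k) * entropyH (μ k) Q ≤
      ENNReal.ofReal (a k) * partEntropy (μ k) P := fun k => by
    rcases eq_or_ne (ENNReal.ofReal (a k)) 0 with h0 | h0
    · simp [h0]
    · have hnullk : μ k (⋃₀ P)ᶜ = 0 := by
        have h := Measure.sum_apply_eq_zero.1 hnull k
        simpa [h0] using h
      gcongr
      exact iInf_le_of_le P (iInf_le_of_le ⟨hcount, hmeas, hdisj, hnullk⟩ (iInf_le _ hPQ))
  calc ∑' k, ENNReal.ofReal (a k) * entropyH (μ k) Q
      ≤ ∑' k, ENNReal.ofReal (a k) * partEntropy (μ k) P := ENNReal.tsum_le_tsum hk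
    _ = ∑' s : P, ∑' k, ENNReal.ofReal (a k) * ENNReal.ofReal (sh (μ k s).toReal) := by
        simp_rw [partEntropy, ← ENNReal.tsum_mul_left]
        exact ENNReal.tsum_comm
    _ ≤ _ := ENNReal.tsum_le_tsum fun s =>
        tsum_ofReal_mul_sh_le ha hsum
          (fun k => ⟨ENNReal.toReal_nonneg, ENNReal.toReal_le_of_le_ofReal zero_le_one
            (by simpa using prob_le_one)⟩)
          (hasSum_mul_toReal_measure ha hsum.summable μ (hmeas s s.2))

/-- Fatou's lemma for series in `ℝ≥0∞`. -/
lemma tsum_liminf_le_liminf_tsum {ι : Type*} {u : Filter ι} [u.IsCountablyGenerated]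
    (f : ι → ℕ → ℝ≥0∞) :
    ∑' k, Filter.liminf (fun i => f i k) u ≤ Filter.liminf (fun i => ∑' k, f i k) u := by
  simpa only [lintegral_count] using
    lintegral_liminf_le (μ := Measure.count) (u := u) (f := f) fun _ => measurable_from_top

/-- first inequality of Theorem 4 of the paper: for a countable mixture,
`ldim_E(Σ_{k} a_k μ_k) ≥ Σ_{k} a_k ldim_E(μ_k)`. -/
theorem ldimE_countable_mixture_ge {X : Type*} [MetricSpace X] [MeasurableSpace X] [BorelSpace X]
    (a : ℕ → ℝ) (ha : ∀ k, a k ∈ Set.Icc (0 : ℝ) 1) (hsum : ∑' k, a k = 1)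
    (μ : ℕ → Measure X) (hμ : ∀ k, IsProbabilityMeasure (μ k)) :
    ∑' k, ENNReal.ofReal (a k) * ldimE (μ k) ≤
      ldimE (Measure.sum (fun k => ENNReal.ofReal (a k) • μ k)) := by
  have hsummable : Summable a := by
    by_contra h
    simp [tsum_eq_zero_of_not_summable h] at hsum
  have hasSum : HasSum a 1 := hsum ▸ hsummable.hasSum
  simp_rw [ldimE, ← ENNReal.liminf_const_mul_of_ne_top ENNReal.ofReal_ne_top]
  refine (tsum_liminf_le_liminf_tsum _).trans (Filter.liminf_le_liminf (.of_forall fun δ => ?_))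
  simp_rw [← mul_div_assoc, div_eq_mul_inv, ENNReal.tsum_mul_right]
  gcongr
  exact tsum_mul_entropyH_le (fun k => (ha k).1) hasSum μ _
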